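/- arXiv:2009.05003 — 2 statements merged into one kernel-verified Lean document; each statement's English description precedes it below -/
import Mathlib

section
/- Let B : ℝ → ℝ be continuous, λ ∈ ℂ, s ∈ ℝ, and let ζ : ℝ → ℝ be a càdlàg function with ζ(s) = 0. If a càdlàg function h : ℝ → ℂ satisfies h(t) = ∫_s^t 𝒰_λ(t,v)·h(v) dv + ζ(t) for all t ∈ ℝ, then h(t) = ζ(t) + ∫_s^t f'_{λ,u}(t)·ζ(u) du for all t ∈ ℝ, where f'_{λ,u}(t) denotes the value at t of the solution Φ of the stochastic Airy equation based at u with data (1,0). Conversely, the function h defined by this formula satisfies the first equation. -/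
open MeasureTheory Filter Topology Set

/-- The kernel `𝒰_λ(t,u) = (t² − u²)/2 + B(t) − B(u) + λ(t − u)`. -/
noncomputable def Uker (B : ℝ → ℝ) (lam : ℂ) (t u : ℝ) : ℂ :=
  (((t ^ 2 - u ^ 2) / 2 + B t - B u : ℝ) : ℂ) + lam * ((t : ℂ) - (u : ℂ))

/-- `Φ` is a (continuous) solution of the stochastic Airy equation based at `s`
with data `(c₁, c₂)`:  `Φ(t) = c₂ + c₁·𝒰_λ(t,s) + ∫_s^t 𝒰_λ(t,u)·Φ(u) du`. -/
def IsSAESol (B : ℝ → ℝ) (lam : ℂ) (s : ℝ) (c₁ c₂ : ℂ) (Φ : ℝ → ℂ) : Prop :=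
  Continuous Φ ∧
    ∀ t : ℝ, Φ t = c₂ + c₁ * Uker B lam t s + ∫ u in s..t, Uker B lam t u * Φ u

/-- A function is càdlàg if it is right-continuous with left limits. -/
def Cadlag {E : Type*} [TopologicalSpace E] (f : ℝ → E) : Prop :=
  (∀ x : ℝ, ContinuousWithinAt f (Set.Ici x) x) ∧
  (∀ x : ℝ, ∃ l : E, Filter.Tendsto f (nhdsWithin x (Set.Iio x)) (nhds l))

/-- A right-continuous function on the real line is measurable. -/
lemma measurable_of_continuousWithinAt_Ici {E : Type*} [TopologicalSpace E]
    [TopologicalSpace.PseudoMetrizableSpace E] [MeasurableSpace E] [BorelSpace E] {f : ℝ → E}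
    (hf : ∀ x, ContinuousWithinAt f (Ici x) x) : Measurable f := by
  have hm : ∀ n : ℕ, Measurable fun x : ℝ => f ((⌊((n : ℝ) + 1) * x⌋ + 1) / ((n : ℝ) + 1)) := by
    intro n
    have h1 : Measurable fun k : ℤ => f (((k : ℝ) + 1) / ((n : ℝ) + 1)) := measurable_from_top
    exact h1.comp (Int.measurable_floor.comp (measurable_const_mul _))
  refine measurable_of_tendsto_metrizable hm (tendsto_pi_nhds.2 fun x => ?_)
  refine (hf x).tendsto.comp (tendsto_nhdsWithin_iff.2 ⟨?_, Eventually.of_forall fun n => ?_⟩)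
  · have hu : Tendsto (fun n : ℕ => x + 1 / ((n : ℝ) + 1)) atTop (𝓝 x) := by
      simpa using tendsto_const_nhds.add (tendsto_one_div_add_atTop_nhds_zero_nat (𝕜 := ℝ))
    refine tendsto_of_tendsto_of_tendsto_of_le_of_le tendsto_const_nhds hu ?_ ?_
    · intro n
      have hn : (0 : ℝ) < n + 1 := by positivity
      show x ≤ _
      rw [le_div_iff₀ hn]
      linarith [Int.lt_floor_add_one (((n : ℝ) + 1) * x)]
    · intro n
      have hn : (0 : ℝ) < n + 1 := by positivity
      show _ ≤ x + 1 / ((n : ℝ) + 1)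
      have e : (x + 1 / ((n : ℝ) + 1)) * ((n : ℝ) + 1) = ((n : ℝ) + 1) * x + 1 := by field_simp
      rw [div_le_iff₀ hn, e]
      linarith [Int.floor_le (((n : ℝ) + 1) * x)]
  · have hn : (0 : ℝ) < n + 1 := by positivity
    show x ≤ _
    rw [le_div_iff₀ hn]
    linarith [Int.lt_floor_add_one (((n : ℝ) + 1) * x)]

lemma Cadlag.locallyIntegrable {E : Type*} [NormedAddCommGroup E] [SecondCountableTopology E]
    {f : ℝ → E} (hf : Cadlag f) : LocallyIntegrable f := by
  borelize E
  intro x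
  have hm : StronglyMeasurable f :=
    (measurable_of_continuousWithinAt_Ici hf.1).stronglyMeasurable
  have hfin : volume.FiniteAtFilter (𝓝 x) := volume.finiteAt_nhds x
  obtain ⟨l, hl⟩ := hf.2 x
  rw [← nhdsLT_sup_nhdsGE x, IntegrableAtFilter.sup_iff]
  exact ⟨hl.integrableAtFilter (hm.stronglyMeasurableAtFilter) (hfin.filter_mono nhdsWithin_le_nhds),
    (hf.1 x).tendsto.integrableAtFilter (hm.stronglyMeasurableAtFilter)
      (hfin.filter_mono nhdsWithin_le_nhds)⟩

lemma MeasureTheory.LocallyIntegrable.intervalIntegrable_real {E : Type*} [NormedAddCommGroup E]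
    {f : ℝ → E} (hf : LocallyIntegrable f) (a b : ℝ) : IntervalIntegrable f volume a b :=
  (hf.integrableOn_isCompact isCompact_uIcc).intervalIntegrable

lemma integral_triangle_swap_of_le {E : Type*} [NormedAddCommGroup E] [NormedSpace ℝ E]
    {f : ℝ → ℝ → E} {a b : ℝ} (hab : a ≤ b)
    (hf : Integrable (Function.uncurry f)
      ((volume.restrict (Ioc a b)).prod (volume.restrict (Ioc a b)))) :
    (∫ x in a..b, ∫ y in a..x, f x y) = (∫ y in a..b, ∫ x in y..b, f x y) ∧
    IntervalIntegrable (fun x => ∫ y in a..x, f x y) volume a b ∧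
    IntervalIntegrable (fun y => ∫ x in y..b, f x y) volume a b := by
  set g : ℝ → ℝ → E := fun x y => {p : ℝ × ℝ | p.2 ≤ p.1}.indicator (Function.uncurry f) (x, y)
    with hg
  have hgi : Integrable (Function.uncurry g)
      ((volume.restrict (Ioc a b)).prod (volume.restrict (Ioc a b))) :=
    hf.indicator (measurableSet_le measurable_snd measurable_fst)
  have h1 : ∀ x ∈ Ioc a b, (∫ y in Ioc a b, g x y) = ∫ y in a..x, f x y := by
    intro x hx
    have : g x = (Iic x).indicator (f x) := by
      ext y; simp [hg, indicator, Function.uncurry]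
    rw [this, setIntegral_indicator measurableSet_Iic, Ioc_inter_Iic, min_eq_right hx.2,
      intervalIntegral.integral_of_le hx.1.le]
  have h2 : ∀ y ∈ Ioc a b, (∫ x in Ioc a b, g x y) = ∫ x in y..b, f x y := by
    intro y hy
    have : (fun x => g x y) = (Ici y).indicator (fun x => f x y) := by
      ext x; simp [hg, indicator, Function.uncurry]
    have hI : Ioc a b ∩ Ici y = Icc y b := by
      ext x
      simp only [mem_inter_iff, mem_Ioc, mem_Ici, mem_Icc]
      exact ⟨fun h => ⟨h.2, h.1.2⟩, fun h => ⟨⟨hy.1.trans_le h.1, h.2⟩, h.1⟩⟩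
    rw [this, setIntegral_indicator measurableSet_Ici, hI, integral_Icc_eq_integral_Ioc,
      intervalIntegral.integral_of_le hy.2]
  refine ⟨?_, ?_, ?_⟩
  · rw [intervalIntegral.integral_of_le hab, intervalIntegral.integral_of_le hab,
      ← setIntegral_congr_fun measurableSet_Ioc h1, ← setIntegral_congr_fun measurableSet_Ioc h2]
    exact integral_integral_swap hgi
  · rw [intervalIntegrable_iff_integrableOn_Ioc_of_le hab]
    exact IntegrableOn.congr_fun (hgi.integral_prod_left) h1 measurableSet_Ioc
  · rw [intervalIntegrable_iff_integrableOn_Ioc_of_le hab]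
    exact IntegrableOn.congr_fun (hgi.integral_prod_right) h2 measurableSet_Ioc

/-- Dirichlet's formula for interchanging the integrals over an oriented triangle. -/
lemma integral_triangle_swap {E : Type*} [NormedAddCommGroup E] [NormedSpace ℝ E]
    {f : ℝ → ℝ → E} {s t : ℝ}
    (hf : Integrable (Function.uncurry f)
      ((volume.restrict (uIoc s t)).prod (volume.restrict (uIoc s t)))) :
    (∫ x in s..t, ∫ y in s..x, f x y) = (∫ y in s..t, ∫ x in y..t, f x y) ∧
    IntervalIntegrable (fun x => ∫ y in s..x, f x y) volume s t := by
  rcases le_total s t with h | h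
  · rw [uIoc_of_le h] at hf
    exact ⟨(integral_triangle_swap_of_le h hf).1, (integral_triangle_swap_of_le h hf).2.1⟩
  · rw [uIoc_of_ge h] at hf
    obtain ⟨h1, -, h3⟩ := integral_triangle_swap_of_le (f := fun x y => f y x) h hf.swap
    constructor
    · have e1 : ∀ x, (∫ y in s..x, f x y) = -∫ y in x..s, f x y := fun x =>
        intervalIntegral.integral_symm _ _
      have e2 : ∀ y, (∫ x in y..t, f x y) = -∫ x in t..y, f x y := fun y =>
        intervalIntegral.integral_symm _ _
      simp only [e1, e2, intervalIntegral.integral_neg]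
      rw [intervalIntegral.integral_symm t s, intervalIntegral.integral_symm t s, h1]
    · refine h3.symm.neg.congr fun x _ => ?_
      exact (intervalIntegral.integral_symm _ _).symm

lemma integrable_prod_uIoc_mul_snd {K : ℝ → ℝ → ℂ} (hK : Continuous (Function.uncurry K))
    {z : ℝ → ℂ} {a b : ℝ} (hz : IntervalIntegrable z volume a b) :
    Integrable (Function.uncurry fun x y => K x y * z y)
      ((volume.restrict (uIoc a b)).prod (volume.restrict (uIoc a b))) := by
  have : IsFiniteMeasure (volume.restrict (uIoc a b)) := by unfold uIoc; infer_instance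
  have hz' : Integrable z (volume.restrict (uIoc a b)) := hz.def'
  obtain ⟨C, hC⟩ := (isCompact_uIcc (a := a) (b := b)).prod (isCompact_uIcc (a := a) (b := b))
    |>.exists_bound_of_continuousOn hK.continuousOn
  refine Integrable.bdd_mul (c := C) (hz'.comp_snd _) hK.aestronglyMeasurable ?_
  rw [Measure.prod_restrict]
  filter_upwards [ae_restrict_mem (measurableSet_uIoc.prod measurableSet_uIoc)] with p hp
  exact hC p ⟨uIoc_subset_uIcc hp.1, uIoc_subset_uIcc hp.2⟩

lemma le_mul_exp_of_le_add_mul_integral {g : ℝ → ℝ} (hg : Continuous g) {C ε a t : ℝ}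
    (hC : 0 ≤ C) (hg0 : ∀ x, 0 ≤ g x) (hε : 0 ≤ ε) (hat : a ≤ t)
    (h : ∀ x ∈ Icc a t, g x ≤ ε + C * ∫ y in a..x, g y) :
    g t ≤ ε * Real.exp (C * (t - a)) := by
  have hd : ∀ x, HasDerivAt (fun x => ε + C * ∫ y in a..x, g y) (C * g x) x := fun x =>
    ((intervalIntegral.integral_hasDerivAt_right (hg.intervalIntegrable _ _)
      (hg.stronglyMeasurableAtFilter _ _) hg.continuousAt).const_mul C).const_add ε
  have hn : ∀ x, a ≤ x → 0 ≤ ε + C * ∫ y in a..x, g y := fun x hx =>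
    add_nonneg hε (mul_nonneg hC (intervalIntegral.integral_nonneg hx fun y _ => hg0 y))
  have key := norm_le_gronwallBound_of_norm_deriv_right_le (δ := ε) (K := C) (ε := 0)
    (fun x _ => (hd x).continuousAt.continuousWithinAt) (fun x _ => (hd x).hasDerivWithinAt)
    (by simp [abs_of_nonneg hε])
    (fun x hx => by
      rw [Real.norm_of_nonneg (mul_nonneg hC (hg0 x)), Real.norm_of_nonneg (hn x hx.1), add_zero]
      exact mul_le_mul_of_nonneg_left (h x ⟨hx.1, hx.2.le⟩) hC)
    t (right_mem_Icc.2 hat)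
  rw [gronwallBound_ε0, Real.norm_of_nonneg (hn t hat)] at key
  exact (h t (right_mem_Icc.2 hat)).trans key

/-- Grönwall's inequality in integral form, in either direction of time. -/
lemma le_mul_exp_of_le_add_mul_abs_integral {g : ℝ → ℝ} (hg : Continuous g) {C ε a t : ℝ}
    (hC : 0 ≤ C) (hg0 : ∀ x, 0 ≤ g x) (hε : 0 ≤ ε)
    (h : ∀ x ∈ uIcc a t, g x ≤ ε + C * |∫ y in a..x, g y|) :
    g t ≤ ε * Real.exp (C * |t - a|) := by
  rcases le_total a t with hat | hat
  · rw [abs_of_nonneg (sub_nonneg.2 hat)]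
    refine le_mul_exp_of_le_add_mul_integral hg hC hg0 hε hat fun x hx => ?_
    have := h x (by rwa [uIcc_of_le hat])
    rwa [abs_of_nonneg (intervalIntegral.integral_nonneg hx.1 fun y _ => hg0 y)] at this
  · have key := le_mul_exp_of_le_add_mul_integral (g := fun x => g (-x)) (a := -a) (t := -t)
      (hg.comp continuous_neg) hC (fun x => hg0 _) hε (neg_le_neg hat) (fun x hx => by
        have hx' : -x ∈ Icc t a := ⟨by linarith [hx.2], by linarith [hx.1]⟩
        have := h (-x) (by rwa [uIcc_of_ge hat])
        rw [intervalIntegral.integral_symm, abs_neg,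
          abs_of_nonneg (intervalIntegral.integral_nonneg hx'.2 fun y _ => hg0 y)] at this
        simpa [intervalIntegral.integral_comp_neg] using this)
    rw [abs_of_nonpos (sub_nonpos.2 hat)]
    have e : -(t - a) = -t - -a := by ring
    rw [e]
    simpa using key

lemma continuous_uncurry_Uker {B : ℝ → ℝ} (hB : Continuous B) (lam : ℂ) :
    Continuous (Function.uncurry (Uker B lam)) := by
  unfold Uker Function.uncurry
  fun_prop

lemma continuous_Uker {B : ℝ → ℝ} (hB : Continuous B) (lam : ℂ) (t : ℝ) :
    Continuous (Uker B lam t) := by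
  unfold Uker
  fun_prop

lemma exists_Uker_bound {B : ℝ → ℝ} (hB : Continuous B) (lam : ℂ) (T : ℝ) :
    ∃ M, 0 ≤ M ∧ ∀ x ∈ Icc (-T) T, ∀ y ∈ Icc (-T) T, ‖Uker B lam x y‖ ≤ M := by
  obtain ⟨C, hC⟩ := (isCompact_Icc (a := -T) (b := T)).prod (isCompact_Icc (a := -T) (b := T))
    |>.exists_bound_of_continuousOn (continuous_uncurry_Uker hB lam).continuousOn
  exact ⟨max C 0, le_max_right _ _, fun x hx y hy => (hC (x, y) ⟨hx, hy⟩).trans (le_max_left _ _)⟩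

lemma norm_integral_Uker_mul_le {B : ℝ → ℝ} {lam : ℂ} {T M : ℝ}
    (hM : ∀ x ∈ Icc (-T) T, ∀ y ∈ Icc (-T) T, ‖Uker B lam x y‖ ≤ M)
    {a b t : ℝ} (ha : a ∈ Icc (-T) T) (hb : b ∈ Icc (-T) T) (ht : t ∈ Icc (-T) T)
    (hM0 : 0 ≤ M) {f : ℝ → ℂ} (hf : Continuous f) :
    ‖∫ v in a..b, Uker B lam t v * f v‖ ≤ M * |∫ v in a..b, ‖f v‖| := by
  have h1 := intervalIntegral.norm_integral_le_abs_of_norm_le (μ := volume) (a := a) (b := b)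
    (f := fun v => Uker B lam t v * f v) (g := fun v => M * ‖f v‖)
    ((ae_restrict_iff' measurableSet_uIoc).2 (Eventually.of_forall fun v hv => by
      rw [norm_mul]
      exact mul_le_mul_of_nonneg_right
        (hM t ht v (uIcc_subset_Icc ha hb (uIoc_subset_uIcc hv))) (norm_nonneg _)))
    ((hf.norm.const_mul M).intervalIntegrable _ _)
  rwa [intervalIntegral.integral_const_mul, abs_mul, abs_of_nonneg hM0] at h1

/-- The homogeneous Volterra equation has only the trivial locally integrable solution. -/
lemma eq_zero_of_eq_integral_Uker_mul {B : ℝ → ℝ} (hB : Continuous B) {lam : ℂ} {s : ℝ}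
    {d : ℝ → ℂ} (hd : ∀ a b, IntervalIntegrable d volume a b)
    (h : ∀ t, d t = ∫ v in s..t, Uker B lam t v * d v) (t : ℝ) : d t = 0 := by
  let b : ℝ → ℂ := fun x => ((x ^ 2 / 2 + B x : ℝ) : ℂ) + lam * x
  have hb : Continuous b := by fun_prop
  have hbd : ∀ a c, IntervalIntegrable (fun v => b v * d v) volume a c := fun a c =>
    (hd a c).continuousOn_mul hb.continuousOn
  have hU : ∀ x v, Uker B lam x v = b x - b v := fun x v => by
    simp only [Uker, b]; push_cast; ring
  have hdc : Continuous d := by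
    have : d = fun t => b t * (∫ v in s..t, d v) - ∫ v in s..t, b v * d v := by
      ext t
      rw [h t, ← intervalIntegral.integral_const_mul,
        ← intervalIntegral.integral_sub ((hd s t).const_mul _) (hbd s t)]
      exact intervalIntegral.integral_congr fun v _ => by simp only [hU]; ring
    rw [this]
    exact (hb.mul (intervalIntegral.continuous_primitive hd s)).sub
      (intervalIntegral.continuous_primitive hbd s)
  obtain ⟨M, hM0, hM⟩ := exists_Uker_bound hB lam (max |s| |t|)
  have hs : s ∈ Icc (-(max |s| |t|)) (max |s| |t|) := abs_le.1 (le_max_left _ _)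
  have ht : t ∈ Icc (-(max |s| |t|)) (max |s| |t|) := abs_le.1 (le_max_right _ _)
  have := le_mul_exp_of_le_add_mul_abs_integral (g := fun x => ‖d x‖) (ε := 0) (a := s) (t := t)
    hdc.norm hM0 (fun _ => norm_nonneg _) le_rfl (fun x hx => by
      have hx' := uIcc_subset_Icc hs ht hx
      rw [zero_add, h x]
      exact norm_integral_Uker_mul_le hM hs hx' hx' hM0 hdc)
  rw [zero_mul] at this
  exact norm_le_zero_iff.1 this

/-- Two Dirichlet solutions with nearby base points are close on compact time intervals. -/
lemma IsSAESol.norm_sub_le {B : ℝ → ℝ} (hB : Continuous B) {lam : ℂ} {T M : ℝ} (hM0 : 0 ≤ M)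
    (hM : ∀ x ∈ Icc (-T) T, ∀ y ∈ Icc (-T) T, ‖Uker B lam x y‖ ≤ M)
    {Φ : ℝ → ℝ → ℂ} (hΦ : ∀ u, IsSAESol B lam u 1 0 (Φ u)) {u u₀ t : ℝ}
    (hu : u ∈ Icc (-T) T) (hu₀ : u₀ ∈ Icc (-T) T) (ht : t ∈ Icc (-T) T) :
    ‖Φ u t - Φ u₀ t‖ ≤
      (‖Uker B lam u₀ u‖ + M * |∫ v in u..u₀, ‖Φ u₀ v‖|) * Real.exp (M * (2 * T)) := by
  have hε0 : 0 ≤ ‖Uker B lam u₀ u‖ + M * |∫ v in u..u₀, ‖Φ u₀ v‖| := by positivity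
  have hdiff : ∀ x, Φ u x - Φ u₀ x = Uker B lam u₀ u
      + (∫ v in u..u₀, Uker B lam x v * Φ u₀ v)
      + ∫ v in u..x, Uker B lam x v * (Φ u v - Φ u₀ v) := by
    intro x
    have hi : ∀ w a b, IntervalIntegrable (fun v => Uker B lam x v * Φ w v) volume a b :=
      fun w a b => ((continuous_Uker hB lam x).mul (hΦ w).1).intervalIntegrable _ _
    have e1 : (∫ v in u..x, Uker B lam x v * (Φ u v - Φ u₀ v))
        = (∫ v in u..x, Uker B lam x v * Φ u v) - ∫ v in u..x, Uker B lam x v * Φ u₀ v := by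
      rw [← intervalIntegral.integral_sub (hi _ _ _) (hi _ _ _)]
      simp only [mul_sub]
    rw [e1, ← intervalIntegral.integral_add_adjacent_intervals (hi u₀ u u₀) (hi u₀ u₀ x),
      (hΦ u).2 x, (hΦ u₀).2 x]
    simp only [Uker]
    push_cast
    ring
  have hg := le_mul_exp_of_le_add_mul_abs_integral (g := fun x => ‖Φ u x - Φ u₀ x‖)
    (C := M) (ε := ‖Uker B lam u₀ u‖ + M * |∫ v in u..u₀, ‖Φ u₀ v‖|) (a := u) (t := t) ((hΦ u).1.sub (hΦ u₀).1).norm hM0 (fun _ => norm_nonneg _)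
    hε0 (fun x hx => by
      have hx' := uIcc_subset_Icc hu ht hx
      rw [hdiff x]
      refine (norm_add₃_le).trans (add_le_add (add_le_add le_rfl ?_) ?_)
      · exact norm_integral_Uker_mul_le hM hu hu₀ hx' hM0 (hΦ u₀).1
      · exact norm_integral_Uker_mul_le hM hu hx' hx' hM0 ((hΦ u).1.sub (hΦ u₀).1))
  refine hg.trans (mul_le_mul_of_nonneg_left (Real.exp_le_exp.2
    (mul_le_mul_of_nonneg_left ?_ hM0)) hε0)
  rw [abs_le]
  constructor <;> linarith [hu.1, hu.2, ht.1, ht.2]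

/-- The Dirichlet solutions depend continuously on base point and time jointly. -/
lemma IsSAESol.continuous_uncurry {B : ℝ → ℝ} (hB : Continuous B) {lam : ℂ}
    {Φ : ℝ → ℝ → ℂ} (hΦ : ∀ u, IsSAESol B lam u 1 0 (Φ u)) :
    Continuous (Function.uncurry Φ) := by
  rw [continuous_iff_continuousAt]
  rintro ⟨u₀, t₀⟩
  set T : ℝ := max |u₀| |t₀| + 1
  obtain ⟨M, hM0, hM⟩ := exists_Uker_bound hB lam T
  have hu₀ : u₀ ∈ Ioo (-T) T := abs_lt.1 (by linarith [le_max_left |u₀| |t₀|])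
  have ht₀ : t₀ ∈ Ioo (-T) T := abs_lt.1 (by linarith [le_max_right |u₀| |t₀|])
  have hcΦ := (hΦ u₀).1
  let ε : ℝ → ℝ := fun u => ‖Uker B lam u₀ u‖ + M * |∫ v in u..u₀, ‖Φ u₀ v‖|
  have hεc : Continuous ε := by
    have h1 : Continuous fun u => Uker B lam u₀ u := continuous_Uker hB lam u₀
    have h2 : Continuous fun u => ∫ v in u..u₀, ‖Φ u₀ v‖ := by
      simp_rw [intervalIntegral.integral_symm u₀]
      exact (intervalIntegral.continuous_primitive
        (fun _ _ => hcΦ.norm.intervalIntegrable _ _) u₀).neg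
    exact h1.norm.add (h2.abs.const_mul M)
  have hεu₀ : ε u₀ = 0 := by simp [ε, Uker]
  rw [ContinuousAt, tendsto_iff_norm_sub_tendsto_zero]
  have hlim : Tendsto (fun p : ℝ × ℝ =>
      ε p.1 * Real.exp (M * (2 * T)) + ‖Φ u₀ p.2 - Φ u₀ t₀‖) (𝓝 (u₀, t₀)) (𝓝 0) := by
    have : Continuous fun p : ℝ × ℝ =>
        ε p.1 * Real.exp (M * (2 * T)) + ‖Φ u₀ p.2 - Φ u₀ t₀‖ := by fun_prop
    simpa [hεu₀] using this.tendsto (u₀, t₀)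
  refine squeeze_zero' (Eventually.of_forall fun _ => norm_nonneg _) ?_ hlim
  filter_upwards [(isOpen_Ioo.prod isOpen_Ioo).mem_nhds
    (show (u₀, t₀) ∈ Ioo (-T) T ×ˢ Ioo (-T) T from ⟨hu₀, ht₀⟩)] with p hp
  calc ‖Function.uncurry Φ p - Function.uncurry Φ (u₀, t₀)‖
      = ‖(Φ p.1 p.2 - Φ u₀ p.2) + (Φ u₀ p.2 - Φ u₀ t₀)‖ := by
        rw [sub_add_sub_cancel]; rfl
    _ ≤ ‖Φ p.1 p.2 - Φ u₀ p.2‖ + ‖Φ u₀ p.2 - Φ u₀ t₀‖ := norm_add_le _ _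
    _ ≤ _ := add_le_add_left
        (norm_sub_le hB hM0 hM hΦ (Ioo_subset_Icc_self hp.1)
        (Ioo_subset_Icc_self hu₀) (Ioo_subset_Icc_self hp.2)) _

/-- The resolvent formula solves the forced Volterra equation. -/
lemma forced_eq_of_resolvent {B : ℝ → ℝ} (hB : Continuous B) {lam : ℂ} {s : ℝ} {z : ℝ → ℂ}
    (hz : ∀ a b, IntervalIntegrable z volume a b)
    {Φ : ℝ → ℝ → ℂ} (hΦ : ∀ u, IsSAESol B lam u 1 0 (Φ u)) {h : ℝ → ℂ}
    (hh : ∀ t, h t = z t + ∫ u in s..t, Φ u t * z u) :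
    (∀ a b, IntervalIntegrable h volume a b) ∧
      ∀ t, h t = (∫ v in s..t, Uker B lam t v * h v) + z t := by
  have hΦc := IsSAESol.continuous_uncurry hB hΦ
  have hΦc' : Continuous fun p : ℝ × ℝ => Φ p.2 p.1 := hΦc.comp continuous_swap
  have hUc : ∀ t, Continuous (Uker B lam t) := continuous_Uker hB lam
  have hRi : ∀ t, IntervalIntegrable (fun v => ∫ u in s..v, Φ u v * z u) volume s t := fun t =>
    (integral_triangle_swap (integrable_prod_uIoc_mul_snd (K := fun v u => Φ u v)
      hΦc' (hz s t))).2
  refine ⟨fun a b => ?_, fun t => ?_⟩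
  · rw [funext hh]
    exact (hz a b).add ((hRi a).symm.trans (hRi b))
  have hK : Continuous (Function.uncurry fun v u => Uker B lam t v * Φ u v) :=
    ((hUc t).comp continuous_fst).mul hΦc'
  have hswap := (integral_triangle_swap
    (integrable_prod_uIoc_mul_snd (K := fun v u => Uker B lam t v * Φ u v) hK (hz s t))).1
  have hin : ∀ u, (∫ v in u..t, Uker B lam t v * Φ u v * z u)
      = Φ u t * z u - Uker B lam t u * z u := by
    intro u
    rw [intervalIntegral.integral_mul_const, ← sub_mul, (hΦ u).2 t]
    ring
  have hΦt : Continuous fun u => Φ u t := hΦc.comp (Continuous.prodMk_left t)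
  have hUz := (hz s t).continuousOn_mul (hUc t).continuousOn
  have hΦz := (hz s t).continuousOn_mul hΦt.continuousOn
  simp_rw [hin] at hswap
  rw [intervalIntegral.integral_sub hΦz hUz] at hswap
  have hsplit : (∫ v in s..t, Uker B lam t v * h v) = (∫ v in s..t, Uker B lam t v * z v)
      + ∫ v in s..t, ∫ u in s..v, Uker B lam t v * Φ u v * z u := by
    rw [intervalIntegral.integral_congr (f := fun v => ∫ u in s..v, Uker B lam t v * Φ u v * z u)
      (g := fun v => Uker B lam t v * ∫ u in s..v, Φ u v * z u) (fun v _ => by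
        simp only [mul_assoc, intervalIntegral.integral_const_mul]),
      ← intervalIntegral.integral_add hUz ((hRi t).continuousOn_mul (hUc t).continuousOn)]
    simp only [← mul_add, ← hh]
  rw [hsplit, hswap, hh t]
  ring

/-- Solution of the stochastic Airy equation with a forcing term `ζ`, represented
through the stochastic Airy kernel: here `ΦF u = f'_{λ,u}` is the solution of the
stochastic Airy equation based at `u` with data `(1,0)`. -/
theorem stmt5 (B : ℝ → ℝ) (hB : Continuous B) (lam : ℂ) (s : ℝ)
    (ζ : ℝ → ℝ) (hζ : Cadlag ζ) (hζs : ζ s = 0)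
    (ΦF : ℝ → ℝ → ℂ) (hΦF : ∀ u : ℝ, IsSAESol B lam u 1 0 (ΦF u)) :
    (∀ h : ℝ → ℂ, Cadlag h →
      (∀ t : ℝ, h t = (∫ v in s..t, Uker B lam t v * h v) + (ζ t : ℂ)) →
      ∀ t : ℝ, h t = (ζ t : ℂ) + ∫ u in s..t, ΦF u t * (ζ u : ℂ)) ∧
    (∀ h : ℝ → ℂ,
      (∀ t : ℝ, h t = (ζ t : ℂ) + ∫ u in s..t, ΦF u t * (ζ u : ℂ)) →
      ∀ t : ℝ, h t = (∫ v in s..t, Uker B lam t v * h v) + (ζ t : ℂ)) := by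
  have hz : ∀ a b, IntervalIntegrable (fun u => (ζ u : ℂ)) volume a b := fun a b =>
    have h := hζ.locallyIntegrable.intervalIntegrable_real a b
    ⟨h.1.ofReal, h.2.ofReal⟩
  refine ⟨fun h hc hh t => ?_, fun h hh => (forced_eq_of_resolvent hB hz hΦF hh).2⟩
  obtain ⟨hki, hk⟩ := forced_eq_of_resolvent hB hz hΦF (s := s)
    (h := fun t => (ζ t : ℂ) + ∫ u in s..t, ΦF u t * (ζ u : ℂ)) fun _ => rfl
  have hhi := hc.locallyIntegrable.intervalIntegrable_real
  refine sub_eq_zero.1 (eq_zero_of_eq_integral_Uker_mul hB (lam := lam) (s := s)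
    (d := fun t => h t - ((ζ t : ℂ) + ∫ u in s..t, ΦF u t * (ζ u : ℂ)))
    (fun a b => (hhi a b).sub (hki a b)) (fun x => ?_) t)
  have hU : ContinuousOn (Uker B lam x) (uIcc s x) :=
    (continuous_Uker hB lam x).continuousOn
  simp only [mul_sub]
  rw [intervalIntegral.integral_sub ((hhi s x).continuousOn_mul hU)
    ((hki s x).continuousOn_mul hU)]
  linear_combination hh x - hk x
end

section
/- Let B : ℝ → ℝ be continuous and λ ∈ ℂ. (i) Every C¹ solution φ of the stochastic Airy equation based at some s ∈ ℝ with data (c₁, c₂) ≠ (0, 0) has the property that φ and φ' have no common zero; in particular all zeros of φ are simple and form a locally finite set. (ii) If λ ∈ ℝ and (c₁, c₂) ∈ ℝ² with c₁ ≠ 0, then φ is real-valued and for every t ≥ s with φ(t) ≠ 0 one has φ(t) = c₁·(−1)^{N_{[s,t)}}·exp( pv∫_s^t (φ'(u)/φ(u)) du ), where N_{[s,t)} is the number of zeros of φ in [s,t) and the principal value is the limit as ε → 0⁺ of the integral over [s,t] with the ε-neighbourhoods of the zeros of φ removed. -/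
open MeasureTheory Filter Topology Set

/-- A solution of a linear differential equation with continuous coefficients which vanishes at
one point vanishes identically. -/
theorem eq_zero_of_hasDerivAt_clm {𝕜 E : Type*} [RCLike 𝕜] [NormedAddCommGroup E]
    [NormedSpace 𝕜 E] [NormedSpace ℝ E] {A : ℝ → E →L[𝕜] E} (hA : Continuous A) {y : ℝ → E}
    (hy : ∀ t, HasDerivAt y (A t (y t)) t) {t₀ : ℝ} (h₀ : y t₀ = 0) (t : ℝ) : y t = 0 := by
  obtain ⟨a, b, ht, ht₀⟩ : ∃ a b, t ∈ Ioo a b ∧ t₀ ∈ Ioo a b := by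
    use min t t₀ - 1, max t t₀ + 1
    grind
  obtain ⟨C, hC⟩ := (isCompact_Icc (a := a) (b := b)).exists_bound_of_continuousOn hA.continuousOn
  have hC' : ∀ u ∈ Ioo a b, ‖A u‖₊ ≤ C.toNNReal := fun u hu =>
    NNReal.le_toNNReal_of_coe_le (hC u (Ioo_subset_Icc_self hu))
  exact ODE_solution_unique_of_mem_Icc (v := fun u x => A u x) (s := fun _ => univ)
    (K := C.toNNReal) (g := fun _ => 0)
    (fun u hu => ((A u).lipschitz.weaken (hC' u hu)).lipschitzOnWith) ht₀
    (fun u _ => (hy u).continuousAt.continuousWithinAt) (fun u _ => hy u) (fun _ _ => mem_univ _)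
    continuousOn_const (fun u _ => by simpa using hasDerivAt_const u (0 : E))
    (fun _ _ => mem_univ _) h₀ (Ioo_subset_Icc_self ht)

/-- Uniqueness for the system `f' = V f + w`, `w' = -V (V f + w)`, which is the first order form
of the equation `f'' = V' f` for a potential `V` that is merely continuous. -/
theorem eq_zero_of_quasiderivative_system {𝕜 : Type*} [RCLike 𝕜] {V f w : ℝ → 𝕜}
    (hV : Continuous V) (hf : ∀ t, HasDerivAt f (V t * f t + w t) t)
    (hw : ∀ t, HasDerivAt w (-(V t * (V t * f t + w t))) t) {t₀ : ℝ} (hf₀ : f t₀ = 0)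
    (hw₀ : w t₀ = 0) (t : ℝ) : f t = 0 ∧ w t = 0 := by
  let p := ContinuousLinearMap.fst 𝕜 𝕜 𝕜
  let q := ContinuousLinearMap.snd 𝕜 𝕜 𝕜
  let A : ℝ → 𝕜 × 𝕜 →L[𝕜] 𝕜 × 𝕜 := fun t =>
    V t • p.prod (-q) + V t ^ 2 • (0 : 𝕜 × 𝕜 →L[𝕜] 𝕜).prod (-p) + q.prod 0
  have hA : Continuous A := by fun_prop
  have hy : ∀ t, HasDerivAt (fun t => (f t, w t)) (A t (f t, w t)) t := fun t => by
    convert (hf t).prodMk (hw t) using 1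
    ext <;> simp [A, p, q]
    ring
  simpa using eq_zero_of_hasDerivAt_clm hA hy (t₀ := t₀) (by simp [hf₀, hw₀]) t

/-- The zeros of a differentiable function without multiple zeros are locally finite. -/
theorem finite_zeros_inter_Icc {E : Type*} [NormedAddCommGroup E] [NormedSpace ℝ E]
    {f g : ℝ → E} (hf : ∀ t, HasDerivAt f (g t) t) (h : ∀ t, f t = 0 → g t ≠ 0) (a b : ℝ) :
    {t : ℝ | a ≤ t ∧ t ≤ b ∧ f t = 0}.Finite := by
  by_contra hinf
  obtain ⟨z, -, hz⟩ := Set.Infinite.exists_accPt_of_subset_isCompact hinf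
    (isCompact_Icc (a := a) (b := b)) (fun t ht => ⟨ht.1, ht.2.1⟩)
  have hfreq : ∃ᶠ y in 𝓝[≠] z, f y = 0 :=
    (accPt_iff_frequently_nhdsNE.1 hz).mono fun y hy => hy.2.2
  have hcont : Continuous f := continuous_iff_continuousAt.2 fun t => (hf t).continuousAt
  have hfz : f z = 0 :=
    (isClosed_singleton.preimage hcont).mem_of_frequently_of_tendsto hfreq
      (tendsto_id.mono_left nhdsWithin_le_nhds)
  exact hfreq ((hf z).eventually_ne (h z hfz))

section Real

variable {f g : ℝ → ℝ} {a b : ℝ}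

/-- A nonvanishing continuous function on an interval has the same sign at both end points. -/
theorem mul_pos_of_ne_zero_on_Icc (hf : Continuous f) (hab : a ≤ b)
    (h : ∀ t ∈ Icc a b, f t ≠ 0) : 0 < f a * f b := by
  by_contra! hle
  have hmem : (0 : ℝ) ∈ uIcc (f a) (f b) := by
    rw [mem_uIcc]
    rcases mul_nonpos_iff.1 hle with h' | h'
    · exact Or.inr ⟨h'.2, h'.1⟩
    · exact Or.inl h'
  obtain ⟨t, ht, ht0⟩ := intermediate_value_uIcc hf.continuousOn hmem
  rw [uIcc_of_le hab] at ht
  exact h t ht ht0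

/-- The logarithmic derivative of a nonvanishing `C¹` function integrates to the increment of the
logarithm. -/
theorem integrableOn_and_integral_logDeriv (hf : ∀ t, HasDerivAt f (g t) t) (hg : Continuous g)
    (hab : a ≤ b) (h : ∀ t ∈ Icc a b, f t ≠ 0) :
    IntegrableOn (fun u => g u / f u) (Icc a b) ∧
      ∫ u in Ioc a b, g u / f u = Real.log (f b) - Real.log (f a) := by
  have hcont : Continuous f := continuous_iff_continuousAt.2 fun t => (hf t).continuousAt
  have hI : IntegrableOn (fun u => g u / f u) (Icc a b) :=
    (hg.continuousOn.div hcont.continuousOn h).integrableOn_Icc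
  refine ⟨hI, ?_⟩
  rw [← intervalIntegral.integral_of_le hab]
  refine intervalIntegral.integral_eq_sub_of_hasDerivAt (f := fun t => Real.log (f t))
    (fun t ht => ?_) ?_
  · rw [uIcc_of_le hab] at ht
    exact (hf t).log (h t ht)
  · exact (intervalIntegrable_iff_integrableOn_Icc_of_le hab).2 hI

/-- Near a simple zero the values on both sides are asymptotically opposite. -/
theorem tendsto_div_of_simple_zero {z d : ℝ} (hf : HasDerivAt f d z) (hz : f z = 0)
    (hd : d ≠ 0) : Tendsto (fun ε => f (z - ε) / f (z + ε)) (𝓝[>] 0) (𝓝 (-1)) := by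
  have h := hf.tendsto_slope_zero
  have h₁ : Tendsto (fun ε : ℝ => ε⁻¹ • (f (z + ε) - f z)) (𝓝[>] 0) (𝓝 d) :=
    h.mono_left (nhdsWithin_mono _ fun ε (hε : 0 < ε) => hε.ne')
  have hneg : Tendsto (fun ε : ℝ => -ε) (𝓝[>] 0) (𝓝[≠] 0) := by
    refine tendsto_nhdsWithin_iff.2 ⟨?_, ?_⟩
    · exact (continuous_neg.tendsto' (0 : ℝ) 0 neg_zero).mono_left nhdsWithin_le_nhds
    · filter_upwards [self_mem_nhdsWithin] with ε hε
      exact neg_ne_zero.2 (ne_of_gt hε)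
  have h₃ := ((h.comp hneg).div h₁ hd).neg
  rw [div_self hd] at h₃
  refine h₃.congr' ?_
  filter_upwards [self_mem_nhdsWithin] with ε hε
  have hε' : ε ≠ 0 := ne_of_gt hε
  simp only [Pi.div_apply, Function.comp_apply, smul_eq_mul, hz, sub_zero, inv_neg, neg_mul,
    neg_div, neg_neg, ← sub_eq_add_neg]
  exact mul_div_mul_left _ _ (inv_ne_zero hε')

/-- The zeros of `f` in `[a, b)`. -/
def zerosIco (f : ℝ → ℝ) (a b : ℝ) : Set ℝ := {z | a ≤ z ∧ z < b ∧ f z = 0}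

/-- The interval `[a, b]` with the closed `ε`-neighbourhoods of the zeros of `f` removed. -/
def puncturedIcc (f : ℝ → ℝ) (a b ε : ℝ) : Set ℝ :=
  Icc a b \ ⋃ z ∈ zerosIco f a b, Icc (z - ε) (z + ε)

/-- If `z` is the only zero of `f` in `[m, b]`, then for small `ε` the punctured interval
`[a, b]` splits into the punctured interval `[a, m]` and the two sides of `z`. -/
theorem eventually_puncturedIcc_eq {m z : ℝ} (ham : a ≤ m) (hmz : m < z) (hzb : z < b)
    (hz : f z = 0) (hmz' : ∀ t ∈ Icc m b, f t = 0 → t = z)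
    (hfin : (zerosIco f a m).Finite) :
    zerosIco f a b = insert z (zerosIco f a m) ∧ ∀ᶠ ε in 𝓝[>] (0 : ℝ),
      puncturedIcc f a b ε = puncturedIcc f a m ε ∪ (Ioo m (z - ε) ∪ Ioc (z + ε) b) := by
  have hins : zerosIco f a b = insert z (zerosIco f a m) := by
    ext t
    simp only [zerosIco, mem_ofPred_eq, mem_insert_iff]
    constructor
    · rintro ⟨h₁, h₂, h₃⟩
      by_cases htm : t < m
      · exact Or.inr ⟨h₁, htm, h₃⟩
      · exact Or.inl (hmz' t ⟨not_lt.1 htm, h₂.le⟩ h₃)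
    · rintro (rfl | ⟨h₁, h₂, h₃⟩)
      · exact ⟨ham.trans hmz.le, hzb, hz⟩
      · exact ⟨h₁, by linarith, h₃⟩
  refine ⟨hins, ?_⟩
  have hlt : ∀ c : ℝ, 0 < c → ∀ᶠ ε in 𝓝[>] (0 : ℝ), ε < c := fun c hc =>
    nhdsWithin_le_nhds (eventually_lt_nhds hc)
  have hev : ∀ᶠ ε in 𝓝[>] (0 : ℝ), ∀ y ∈ zerosIco f a m, ε < m - y :=
    (eventually_all_finite hfin).2 fun y hy => hlt _ (sub_pos.2 hy.2.1)
  filter_upwards [hev, hlt (z - m) (sub_pos.2 hmz), hlt (b - z) (sub_pos.2 hzb),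
    self_mem_nhdsWithin] with ε h₁ h₂ h₃ h₀
  have h₀' : 0 < ε := h₀
  ext t
  simp only [puncturedIcc, hins, biUnion_insert, Set.mem_sdiff, mem_union, mem_iUnion, mem_Icc,
    mem_Ioo, mem_Ioc, not_or, not_exists, not_and, not_le]
  constructor
  · rintro ⟨⟨hat, htb⟩, hzt, hZ⟩
    by_cases htm : t ≤ m
    · exact Or.inl ⟨⟨hat, htm⟩, hZ⟩
    · by_cases htz : z - ε ≤ t
      · exact Or.inr (Or.inr ⟨hzt htz, htb⟩)
      · exact Or.inr (Or.inl ⟨not_le.1 htm, not_le.1 htz⟩)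
  · rintro (⟨⟨hat, htm⟩, hZ⟩ | ⟨hmt, htz⟩ | ⟨hzt, htb⟩)
    · exact ⟨⟨hat, by linarith⟩, fun _ => by linarith, hZ⟩
    · exact ⟨⟨by linarith, by linarith⟩, fun _ => by linarith,
        fun y hy _ => by linarith [h₁ y hy]⟩
    · exact ⟨⟨by linarith, htb⟩, fun _ => hzt, fun y hy _ => by linarith [h₁ y hy]⟩

/-- The sign and the principal value of the logarithmic derivative of a `C¹` function with simple
zeros only. -/
theorem sign_and_tendsto_integral_logDeriv (hf : ∀ t, HasDerivAt f (g t) t) (hg : Continuous g)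
    (h : ∀ t, f t = 0 → g t ≠ 0) (hab : a ≤ b) (ha : f a ≠ 0) (hb : f b ≠ 0) :
    0 < (-1) ^ (zerosIco f a b).ncard * (f a * f b) ∧
      (∀ᶠ ε in 𝓝[>] (0 : ℝ), IntegrableOn (fun u => g u / f u) (puncturedIcc f a b ε)) ∧
      Tendsto (fun ε => ∫ u in puncturedIcc f a b ε, g u / f u) (𝓝[>] 0)
        (𝓝 (Real.log (f b) - Real.log (f a))) := by
  have hcont : Continuous f := continuous_iff_continuousAt.2 fun t => (hf t).continuousAt
  have hfin : ∀ a b, (zerosIco f a b).Finite := fun a b =>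
    (finite_zeros_inter_Icc hf h a b).subset fun t ht => ⟨ht.1, ht.2.1.le, ht.2.2⟩
  induction hn : (zerosIco f a b).ncard generalizing b with
  | zero =>
    have hZ : zerosIco f a b = ∅ := (ncard_eq_zero (hfin a b)).1 hn
    have hne : ∀ t ∈ Icc a b, f t ≠ 0 := fun t ht ht0 => by
      rcases ht.2.eq_or_lt with rfl | hlt
      · exact hb ht0
      · exact eq_empty_iff_forall_notMem.1 hZ t ⟨ht.1, hlt, ht0⟩
    have hS : ∀ ε, puncturedIcc f a b ε = Icc a b := fun ε => by simp [puncturedIcc, hZ]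
    obtain ⟨hI, hint⟩ := integrableOn_and_integral_logDeriv hf hg hab hne
    simp only [hS, integral_Icc_eq_integral_Ioc, hint]
    exact ⟨by simpa using mul_pos_of_ne_zero_on_Icc hcont hab hne, Eventually.of_forall fun _ => hI,
      tendsto_const_nhds⟩
  | succ n ih =>
    obtain ⟨z, hzmem, hzmax⟩ := exists_max_image _ id (hfin a b)
      (nonempty_of_ncard_ne_zero (by omega : (zerosIco f a b).ncard ≠ 0))
    obtain ⟨haz, hzb, hz⟩ := hzmem
    have haz' : a < z := haz.lt_of_ne (by rintro rfl; exact ha hz)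
    -- a point `m` to the left of `z` with no zeros in `[m, z)`
    obtain ⟨l, hlz, hl⟩ : ∃ l < z, ∀ t ∈ Ioo l z, f t ≠ 0 := by
      have := ((hf z).eventually_ne (c := 0) (h z hz)).filter_mono
        (nhdsWithin_mono z fun t (ht : t < z) => ht.ne)
      obtain ⟨l, hl, hsub⟩ := (mem_nhdsLT_iff_exists_Ioo_subset).1 this
      exact ⟨l, hl, hsub⟩
    obtain ⟨m, hm₁, hmz⟩ := exists_between (max_lt haz' hlz)
    obtain ⟨ham, hlm⟩ := max_lt_iff.1 hm₁
    have hm : f m ≠ 0 := hl m ⟨hlm, hmz⟩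
    have huniq : ∀ t ∈ Icc m b, f t = 0 → t = z := fun t ht ht0 => by
      by_contra hne
      rcases lt_or_gt_of_ne hne with htz | htz
      · exact hl t ⟨hlm.trans_le ht.1, htz⟩ ht0
      · have htb : t < b := ht.2.lt_of_ne (by rintro rfl; exact hb ht0)
        exact (hzmax t ⟨ham.le.trans ht.1, htb, ht0⟩).not_gt htz
    obtain ⟨hins, hsplit⟩ :=
      eventually_puncturedIcc_eq ham.le hmz hzb hz huniq (hfin a m)
    have hcard : (zerosIco f a m).ncard = n := by
      have := ncard_insert_of_notMem (a := z) (fun hmem : z ∈ zerosIco f a m =>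
        hmem.2.1.not_gt hmz) (hfin a m)
      rw [hins, this] at hn
      omega
    obtain ⟨hsign, hI, hlim⟩ := ih ham.le hm hcard
    have hratio := tendsto_div_of_simple_zero (hf z) hz (h z hz)
    have hlt : ∀ c : ℝ, 0 < c → ∀ᶠ ε in 𝓝[>] (0 : ℝ), ε < c := fun c hc =>
      nhdsWithin_le_nhds (eventually_lt_nhds hc)
    have hsides : ∀ᶠ ε in 𝓝[>] (0 : ℝ), 0 < ε ∧ ε < z - m ∧ ε < b - z ∧
        (∀ t ∈ Icc m (z - ε), f t ≠ 0) ∧ ∀ t ∈ Icc (z + ε) b, f t ≠ 0 := by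
      filter_upwards [hlt (z - m) (sub_pos.2 hmz), hlt (b - z) (sub_pos.2 hzb),
        self_mem_nhdsWithin] with ε h₁ h₂ h₀
      have h₀' : 0 < ε := h₀
      refine ⟨h₀, h₁, h₂, fun t ht ht0 => ?_, fun t ht ht0 => ?_⟩
      · linarith [huniq t ⟨ht.1, by linarith [ht.2]⟩ ht0, ht.2]
      · linarith [huniq t ⟨by linarith [ht.1], ht.2⟩ ht0, ht.1]
    refine ⟨?_, ?_, ?_⟩
    · obtain ⟨ε, ⟨h₀, h₁, h₂, hl', hr'⟩, hneg⟩ :=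
        (hsides.and (hratio.eventually_lt_const (by norm_num : (-1 : ℝ) < 0))).exists
      have hL := mul_pos_of_ne_zero_on_Icc hcont (by linarith) hl'
      have hR := mul_pos_of_ne_zero_on_Icc hcont (by linarith) hr'
      have hmb : f m * f b < 0 := by
        have hne : f (z + ε) ≠ 0 := hr' _ ⟨le_rfl, by linarith⟩
        have hprod : f (z - ε) * f (z + ε) < 0 := by
          rcases div_neg_iff.1 hneg with h' | h' <;> nlinarith
        by_contra! hcon
        have := mul_pos hL hR
        nlinarith
      have := mul_pos_of_neg_of_neg (mul_neg_of_pos_of_neg hsign hmb) (by norm_num : (-1 : ℝ) < 0)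
      have hsq : 0 < f m ^ 2 := by positivity
      refine pos_of_mul_pos_left (b := f m ^ 2) ?_ hsq.le
      calc _ < _ := this
        _ = _ := by ring
    · filter_upwards [hsplit, hsides, hI] with ε hS ⟨h₀, h₁, h₂, hl', hr'⟩ hIm
      rw [hS]
      exact hIm.union (((integrableOn_and_integral_logDeriv hf hg (by linarith) hl').1.mono_set
        Ioo_subset_Icc_self).union
        ((integrableOn_and_integral_logDeriv hf hg (by linarith) hr').1.mono_set
        Ioc_subset_Icc_self))
    · have hlog : Tendsto (fun ε => Real.log (f (z - ε) / f (z + ε))) (𝓝[>] 0) (𝓝 0) := by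
        simpa using hratio.log (by norm_num)
      have hsum := (hlim.add hlog).add_const (Real.log (f b) - Real.log (f m))
      rw [show Real.log (f m) - Real.log (f a) + 0 + (Real.log (f b) - Real.log (f m)) =
        Real.log (f b) - Real.log (f a) by ring] at hsum
      refine hsum.congr' ?_
      filter_upwards [hsplit, hsides, hI] with ε hS ⟨h₀, h₁, h₂, hl', hr'⟩ hIm
      obtain ⟨hIL, hL⟩ := integrableOn_and_integral_logDeriv hf hg (by linarith) hl'
      obtain ⟨hIR, hR⟩ := integrableOn_and_integral_logDeriv hf hg (by linarith) hr'
      have hdisj : Disjoint (Ioo m (z - ε)) (Ioc (z + ε) b) :=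
        Set.disjoint_left.2 fun t ht ht' => by linarith [ht.2, ht'.1]
      have hdisj' : Disjoint (puncturedIcc f a m ε) (Ioo m (z - ε) ∪ Ioc (z + ε) b) :=
        Set.disjoint_left.2 fun t ht ht' => by
          have := ht.1.2
          rcases ht' with ht' | ht'
          · linarith [ht'.1]
          · linarith [ht'.1]
      have hIL' := hIL.mono_set Ioo_subset_Icc_self
      have hIR' := hIR.mono_set Ioc_subset_Icc_self
      rw [hS, setIntegral_union hdisj' (measurableSet_Ioo.union measurableSet_Ioc) hIm
        (hIL'.union hIR'), setIntegral_union hdisj measurableSet_Ioc hIL' hIR',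
        ← integral_Ioc_eq_integral_Ioo, hL, hR,
        Real.log_div (hl' _ ⟨by linarith, le_rfl⟩) (hr' _ ⟨le_rfl, by linarith⟩)]
      ring

end Real

/-- The first order form of the stochastic Airy equation: with `V t = t² / 2 + B t + λ t`, the
function `W = Φ - V φ` is an antiderivative of `-V Φ`. -/
theorem IsSAESol.hasDerivAt_quasiderivative {B : ℝ → ℝ} (hB : Continuous B) {lam : ℂ} {s : ℝ}
    {c₁ c₂ : ℂ} {Φ φ : ℝ → ℂ} (hΦ : IsSAESol B lam s c₁ c₂ Φ)
    (hφ : ∀ t : ℝ, φ t = c₁ + ∫ u in s..t, Φ u) (t : ℝ) :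
    HasDerivAt (fun t => Φ t - Uker B lam t 0 * φ t) (-(Uker B lam t 0 * Φ t)) t := by
  have hV : Continuous fun t => Uker B lam t 0 := by unfold Uker; fun_prop
  have hsplit : ∀ t u, Uker B lam t u = Uker B lam t 0 - Uker B lam u 0 := fun t u => by
    simp only [Uker]; push_cast; ring
  have hW : (fun t => Φ t - Uker B lam t 0 * φ t) =
      fun t => c₂ - c₁ * Uker B lam s 0 - ∫ u in s..t, Uker B lam u 0 * Φ u := by
    funext t
    have hI₁ : IntervalIntegrable (fun u => Uker B lam t 0 * Φ u) volume s t :=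
      (continuous_const.mul hΦ.1).intervalIntegrable _ _
    have hI₂ : IntervalIntegrable (fun u => Uker B lam u 0 * Φ u) volume s t :=
      (hV.mul hΦ.1).intervalIntegrable _ _
    rw [hΦ.2 t, hφ t, hsplit t s]
    rw [show (fun u => Uker B lam t u * Φ u) =
      fun u => Uker B lam t 0 * Φ u - Uker B lam u 0 * Φ u from
        funext fun u => by rw [hsplit t u, sub_mul]]
    rw [intervalIntegral.integral_sub hI₁ hI₂, intervalIntegral.integral_const_mul]
    ring
  rw [hW]
  exact ((hV.mul hΦ.1).integral_hasStrictDerivAt s t).hasDerivAt.const_sub _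

/-- (i) A nontrivial C¹ solution of the stochastic Airy equation and its derivative
have no common zero; in particular the zeros of `φ` are simple and locally finite.
(ii) For real `λ` and real data with `c₁ ≠ 0`, `φ` is real-valued and satisfies the
principal-value representation `φ(t) = c₁·(−1)^{N_{[s,t)}}·exp(pv ∫_s^t φ'/φ)`. -/
theorem stmt8 (B : ℝ → ℝ) (hB : Continuous B) (lam : ℂ) (s : ℝ) (c₁ c₂ : ℂ)
    (hc : ¬(c₁ = 0 ∧ c₂ = 0)) (Φ φ : ℝ → ℂ)
    (hΦ : IsSAESol B lam s c₁ c₂ Φ)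
    (hφ : ∀ t : ℝ, φ t = c₁ + ∫ u in s..t, Φ u) :
    ((∀ t : ℝ, ¬(φ t = 0 ∧ Φ t = 0)) ∧
      (∀ a b : ℝ, {t : ℝ | a ≤ t ∧ t ≤ b ∧ φ t = 0}.Finite)) ∧
    (lam.im = 0 → c₁.im = 0 → c₂.im = 0 → c₁ ≠ 0 →
      (∀ t : ℝ, (φ t).im = 0) ∧
      (∀ t : ℝ, s ≤ t → φ t ≠ 0 →
        ∃ L : ℝ,
          Tendsto (fun ε : ℝ =>
              ∫ u in Set.Icc s t \
                (⋃ z ∈ {z : ℝ | s ≤ z ∧ z < t ∧ φ z = 0}, Set.Icc (z - ε) (z + ε)),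
                (Φ u).re / (φ u).re)
            (nhdsWithin 0 (Set.Ioi 0)) (𝓝 L) ∧
          φ t = c₁ *
            (((-1 : ℝ) ^ ({z : ℝ | s ≤ z ∧ z < t ∧ φ z = 0}.ncard) * Real.exp L : ℝ) : ℂ))) := by
  set V : ℝ → ℂ := fun t => Uker B lam t 0 with hVdef
  have hV : Continuous V := by simp only [hVdef, Uker]; fun_prop
  have hΦc := hΦ.1
  have hdφ : ∀ t, HasDerivAt φ (Φ t) t := fun t => by
    rw [funext hφ]
    exact (hΦc.integral_hasStrictDerivAt s t).hasDerivAt.const_add c₁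
  have hdW : ∀ t, HasDerivAt (fun t => Φ t - V t * φ t) (-(V t * Φ t)) t :=
    hΦ.hasDerivAt_quasiderivative hB hφ
  have hφs : φ s = c₁ := by simp [hφ s]
  have hΦs : Φ s = c₂ := by rw [hΦ.2 s]; simp [Uker]
  have hno : ∀ t : ℝ, ¬(φ t = 0 ∧ Φ t = 0) := fun t ⟨h₁, h₂⟩ => by
    obtain ⟨hf, hw⟩ := eq_zero_of_quasiderivative_system (w := fun t => Φ t - V t * φ t) hV
      (fun t => by simpa using hdφ t) (fun t => by simpa using hdW t) h₁ (by simp [h₁, h₂]) s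
    refine hc ⟨hφs.symm.trans hf, ?_⟩
    simpa [hf, hΦs] using hw
  refine ⟨⟨hno, finite_zeros_inter_Icc hdφ fun t h₁ h₂ => hno t ⟨h₁, h₂⟩⟩, ?_⟩
  intro hlam him₁ him₂ hc₁
  have hVim : ∀ t, (V t).im = 0 := fun t => by simp [hVdef, Uker, hlam, -Complex.ofReal_pow]
  have him : ∀ t, (φ t).im = 0 ∧ (Φ t).im = 0 := fun t => by
    have hd₁ : ∀ t, HasDerivAt (fun t => (φ t).im) (Φ t).im t := fun t =>
      Complex.imCLM.hasFDerivAt.comp_hasDerivAt t (hdφ t)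
    have hd₂ : ∀ t, HasDerivAt (fun t => (Φ t).im - (V t).re * (φ t).im)
        (-((V t).re * (Φ t).im)) t := fun t => by
      have := Complex.imCLM.hasFDerivAt.comp_hasDerivAt t (hdW t)
      simpa [Function.comp_def, hVim] using this
    obtain ⟨hf, hw⟩ := eq_zero_of_quasiderivative_system (t₀ := s)
      (f := fun t => (φ t).im) (w := fun t => (Φ t).im - (V t).re * (φ t).im)
      (Complex.continuous_re.comp hV)
      (fun t => by simpa using hd₁ t) (fun t => by simpa using hd₂ t)
      (by rw [hφs, him₁]) (by simp [hφs, hΦs, him₁, him₂]) t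
    exact ⟨hf, by simpa only [hf, mul_zero, sub_zero] using hw⟩
  refine ⟨fun t => (him t).1, fun t hst ht => ?_⟩
  have hre : ∀ t, φ t = 0 ↔ (φ t).re = 0 := fun t => by simp [Complex.ext_iff, him t]
  have hd : ∀ t, HasDerivAt (fun t => (φ t).re) (Φ t).re t := fun t =>
    Complex.reCLM.hasFDerivAt.comp_hasDerivAt t (hdφ t)
  have hsimple : ∀ t, (φ t).re = 0 → (Φ t).re ≠ 0 := fun t h₁ h₂ =>
    hno t ⟨(hre t).2 h₁, by simp [Complex.ext_iff, h₂, him t]⟩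
  have hs0 : (φ s).re ≠ 0 := fun h₀ => hc₁ (hφs ▸ (hre s).2 h₀)
  have ht0 : (φ t).re ≠ 0 := fun h₀ => ht ((hre t).2 h₀)
  have hZ : {z : ℝ | s ≤ z ∧ z < t ∧ φ z = 0} = zerosIco (fun t => (φ t).re) s t := by
    simp only [zerosIco, hre]
  obtain ⟨hsign, -, hlim⟩ := sign_and_tendsto_integral_logDeriv hd
    (Complex.continuous_re.comp hΦc) hsimple hst hs0 ht0
  refine ⟨Real.log (φ t).re - Real.log (φ s).re, ?_, ?_⟩
  · simp only [hZ]
    exact hlim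
  · rw [hZ, ← hφs, Complex.ext_iff]
    refine ⟨?_, by simp only [Complex.mul_im, Complex.ofReal_im, him]; simp⟩
    rw [Complex.re_mul_ofReal, Real.exp_sub, Real.exp_log_eq_abs ht0, Real.exp_log_eq_abs hs0]
    have habs : 0 < |(φ s).re| := abs_pos.2 hs0
    rcases neg_one_pow_eq_or ℝ (zerosIco (fun t => (φ t).re) s t).ncard with h₁ | h₁ <;>
      rw [h₁] at hsign ⊢ <;> rcases lt_or_gt_of_ne hs0 with h₂ | h₂ <;>
      rcases lt_or_gt_of_ne ht0 with h₃ | h₃ <;>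
      first
      | (exfalso; nlinarith)
      | (simp only [abs_of_neg, abs_of_pos, h₂, h₃]; field_simp)
end
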